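/- Let (X, k) be the solution of the Skorokhod problem with mean minimality condition and two constraints associated with (h, Y, l, u), and set y_t = E[Y_t]. Then for every q ≥ 0 and every η > 0 with 2η ≤ inf_{t≤q}(ū_t − l̄_t)/3, the total variation of k on [0, q] satisfies |k|_q ≤ 6·( N_η(y, q) + N_η(l̄, q) + N_η(ū, q) + 1 )·( sup_{t≤q} |y_t| + sup_{t≤q} max(|l̄_t|, |ū_t|) ). -/

import Mathlib

open MeasureTheory Filter Set Function Topology

noncomputable section

/-- A function with values in a topological space is càdlàg on `[0,∞)`:
right-continuous at every `t ≥ 0` and admitting a left limit at every `t > 0`. -/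
def CadlagOn {E : Type*} [TopologicalSpace E] (f : ℝ → E) : Prop :=
  (∀ t : ℝ, 0 ≤ t → ContinuousWithinAt f (Set.Ici t) t) ∧
  ∀ t : ℝ, 0 < t → ∃ L : E, Filter.Tendsto f (nhdsWithin t (Set.Iio t)) (nhds L)

/-- Condition (H) on `h : [0,∞) × ℝ → ℝ` with constants `Mh, Lh, ch, Ch`. -/
structure CondH (h : ℝ → ℝ → ℝ) (Mh Lh ch Ch : ℝ) : Prop where
  meas : Measurable (Function.uncurry h)
  Mh_pos : 0 < Mh
  Lh_pos : 0 < Lh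
  ch_pos : 0 < ch
  Ch_pos : 0 < Ch
  growth : ∀ t x : ℝ, 0 ≤ t → |h t x| ≤ Mh * (1 + |x|)
  strict_mono : ∀ t : ℝ, 0 ≤ t → StrictMono (h t)
  lip_time : ∀ s t x : ℝ, 0 ≤ s → 0 ≤ t → |h t x - h s x| ≤ Lh * |t - s|
  lip_lower : ∀ t x y : ℝ, 0 ≤ t → ch * |x - y| ≤ |h t x - h t y|
  lip_upper : ∀ t x y : ℝ, 0 ≤ t → |h t x - h t y| ≤ Ch * |x - y|

/-- A process with càdlàg paths, integrable values, and values uniformly integrable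
on every compact time interval. -/
structure NiceProcess {Ω : Type*} [MeasurableSpace Ω] (μ : Measure Ω) (Y : ℝ → Ω → ℝ) : Prop where
  cadlag : ∀ ω, CadlagOn fun t => Y t ω
  integrable : ∀ t : ℝ, 0 ≤ t → Integrable (Y t) μ
  unifInt : ∀ q : ℝ, 0 ≤ q → UniformIntegrable (fun t : Set.Icc (0:ℝ) q => Y t.1) 1 μ

/-- Solution of the Skorokhod problem with mean minimality condition and two constraints
associated with `(h, Y, l, u)`. -/
def MeanSP {Ω : Type*} [MeasurableSpace Ω] (μ : Measure Ω) (h : ℝ → ℝ → ℝ)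
    (Y : ℝ → Ω → ℝ) (l u : ℝ → ℝ) (X : ℝ → Ω → ℝ) (k : ℝ → ℝ) : Prop :=
  (∀ ω, CadlagOn fun t => X t ω) ∧ CadlagOn k ∧ k 0 = 0 ∧
  (∀ t : ℝ, 0 ≤ t → ∀ ω, X t ω = Y t ω + k t) ∧
  (∀ t : ℝ, 0 ≤ t → (∫ ω, h t (X t ω) ∂μ) ∈ Set.Icc (l t) (u t)) ∧
  (∀ t q : ℝ, 0 ≤ t → t ≤ q →
    ((∀ s : ℝ, t < s → s ≤ q → (∫ ω, h s (X s ω) ∂μ) < u s) → 0 ≤ k q - k t) ∧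
    ((∀ s : ℝ, t < s → s ≤ q → l s < ∫ ω, h s (X s ω) ∂μ) → k q - k t ≤ 0)) ∧
  ∀ t : ℝ, 0 < t →
    ((∫ ω, h t (X t ω) ∂μ) < u t → 0 ≤ k t - Function.leftLim k t) ∧
    (l t < ∫ ω, h t (X t ω) ∂μ → k t - Function.leftLim k t ≤ 0)

/-- Solution of the deterministic Skorokhod problem with two time-dependent barriers. -/
def DetSP (y lb ub x k : ℝ → ℝ) : Prop :=
  CadlagOn x ∧ CadlagOn k ∧ k 0 = 0 ∧
  (∀ t : ℝ, 0 ≤ t → x t = y t + k t ∧ x t ∈ Set.Icc (lb t) (ub t)) ∧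
  (∀ t q : ℝ, 0 ≤ t → t ≤ q →
    ((∀ s : ℝ, t < s → s ≤ q → x s < ub s) → 0 ≤ k q - k t) ∧
    ((∀ s : ℝ, t < s → s ≤ q → lb s < x s) → k q - k t ≤ 0)) ∧
  ∀ t : ℝ, 0 < t →
    (x t < ub t → 0 ≤ k t - Function.leftLim k t) ∧
    (lb t < x t → k t - Function.leftLim k t ≤ 0)

/-- Solution of the Skorokhod problem with mean minimality condition and a single
lower barrier `l`.  The minimality condition `∫ (E[h(s,X_s)] - l_s) dk_s = 0` is expressed
through any measure `ν` that agrees with the Lebesgue–Stieltjes measure of `k` on `[0,∞)`. -/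
def MeanSPLower {Ω : Type*} [MeasurableSpace Ω] (μ : Measure Ω) (h : ℝ → ℝ → ℝ)
    (Y : ℝ → Ω → ℝ) (l : ℝ → ℝ) (X : ℝ → Ω → ℝ) (k : ℝ → ℝ) : Prop :=
  (∀ ω, CadlagOn fun t => X t ω) ∧ CadlagOn k ∧ k 0 = 0 ∧
  (∀ t : ℝ, 0 ≤ t → ∀ ω, X t ω = Y t ω + k t) ∧
  (∀ t : ℝ, 0 ≤ t → l t ≤ ∫ ω, h t (X t ω) ∂μ) ∧
  MonotoneOn k (Set.Ici 0) ∧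
  ∀ ν : Measure ℝ,
    (∀ a b : ℝ, 0 ≤ a → a ≤ b → ν (Set.Ioc a b) = ENNReal.ofReal (k b - k a)) →
    ν {0} = 0 →
    ∀ t : ℝ, 0 ≤ t → (∫ s in Set.Icc 0 t, ((∫ ω, h s (X s ω) ∂μ) - l s) ∂ν) = 0

/-- Solution of the Skorokhod problem with mean minimality condition and a single
upper barrier `u`.  The minimality condition `∫ (u_s - E[h(s,X_s)]) d(-k)_s = 0` is expressed
through any measure `ν` that agrees with the Lebesgue–Stieltjes measure of `-k` on `[0,∞)`. -/
def MeanSPUpper {Ω : Type*} [MeasurableSpace Ω] (μ : Measure Ω) (h : ℝ → ℝ → ℝ)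
    (Y : ℝ → Ω → ℝ) (u : ℝ → ℝ) (X : ℝ → Ω → ℝ) (k : ℝ → ℝ) : Prop :=
  (∀ ω, CadlagOn fun t => X t ω) ∧ CadlagOn k ∧ k 0 = 0 ∧
  (∀ t : ℝ, 0 ≤ t → ∀ ω, X t ω = Y t ω + k t) ∧
  (∀ t : ℝ, 0 ≤ t → (∫ ω, h t (X t ω) ∂μ) ≤ u t) ∧
  AntitoneOn k (Set.Ici 0) ∧
  ∀ ν : Measure ℝ,
    (∀ a b : ℝ, 0 ≤ a → a ≤ b → ν (Set.Ioc a b) = ENNReal.ofReal (k a - k b)) →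
    ν {0} = 0 →
    ∀ t : ℝ, 0 ≤ t → (∫ s in Set.Icc 0 t, (u s - ∫ ω, h s (X s ω) ∂μ) ∂ν) = 0

/-- `OscN x η q` is the number of `η`-oscillations of `x` on `[0,q]`: the largest `m`
for which there are `0 ≤ t₁ ≤ t₂ ≤ ⋯ ≤ t_{2m} ≤ q` with `|x(t_{2i}) - x(t_{2i-1})| > η`. -/
def OscN (x : ℝ → ℝ) (η q : ℝ) : ℕ :=
  sSup {m : ℕ | ∃ a b : Fin m → ℝ,
    (∀ i, 0 ≤ a i ∧ a i ≤ b i ∧ b i ≤ q) ∧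
    (∀ i j, i < j → b i ≤ a j) ∧
    ∀ i, η < |x (b i) - x (a i)|}

/-- The left limit at `t` of a càdlàg function on `[0,∞)`, with the convention
`x(0-) = x(0)`. -/
def leftLimAt {E : Type*} [TopologicalSpace E] (x : ℝ → E) (t : ℝ) : E :=
  if t = 0 then x 0 else Function.leftLim x t

/-- Convergence `xₙ → x` in the Skorokhod `J₁` topology on `D([0,∞), E)`, expressed via
the sequence characterization used in the paper. -/
def DConvOn {E : Type*} [TopologicalSpace E] (xs : ℕ → ℝ → E) (x : ℝ → E) : Prop :=
  ∀ t : ℝ, 0 ≤ t → ∃ tn : ℕ → ℝ,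
    (∀ n, 0 ≤ tn n) ∧ Filter.Tendsto tn Filter.atTop (nhds t) ∧
    ∀ t' t'' : ℕ → ℝ, (∀ n, 0 ≤ t' n) → (∀ n, 0 ≤ t'' n) →
      Filter.Tendsto t' Filter.atTop (nhds t) → Filter.Tendsto t'' Filter.atTop (nhds t) →
      (∀ n, t' n < tn n ∧ tn n ≤ t'' n) →
      Filter.Tendsto (fun n => xs n (t' n)) Filter.atTop (nhds (leftLimAt x t)) ∧
      Filter.Tendsto (fun n => xs n (t'' n)) Filter.atTop (nhds (x t))

/-- There are `m` ordered `η`-oscillations of `f` on `[0,q]`. -/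
def HasOsc (f : ℝ → ℝ) (η q : ℝ) (m : ℕ) : Prop :=
  ∃ a b : Fin m → ℝ,
    (∀ i, 0 ≤ a i ∧ a i ≤ b i ∧ b i ≤ q) ∧
    (∀ i j, i < j → b i ≤ a j) ∧
    ∀ i, η < |f (b i) - f (a i)|

/-- One-sided Cauchy property at every point of `[0,q]`. -/
def Regl (f : ℝ → ℝ) (q : ℝ) : Prop :=
  ∀ t ∈ Set.Icc 0 q, ∀ ε : ℝ, 0 < ε → ∃ δ > 0, ∀ s ∈ Set.Icc 0 q, ∀ r ∈ Set.Icc 0 q,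
    |s - t| < δ → |r - t| < δ → ((s < t ∧ r < t) ∨ (t < s ∧ t < r)) → |f s - f r| < ε

lemma hasOsc_zero (f : ℝ → ℝ) (η q : ℝ) : HasOsc f η q 0 :=
  ⟨Fin.elim0, Fin.elim0, fun i => i.elim0, fun i => i.elim0, fun i => i.elim0⟩

lemma HasOsc.mono {f : ℝ → ℝ} {η q q' : ℝ} {m : ℕ} (H : HasOsc f η q m) (hq : q ≤ q') :
    HasOsc f η q' m := by
  obtain ⟨a, b, h1, h2, h3⟩ := H
  exact ⟨a, b, fun i => ⟨(h1 i).1, (h1 i).2.1, (h1 i).2.2.trans hq⟩, h2, h3⟩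

lemma HasOsc.succ {f : ℝ → ℝ} {η t r s s' : ℝ} {m : ℕ} (H : HasOsc f η t m) (ht : 0 ≤ t)
    (h1 : t ≤ r) (h2 : r ≤ s) (h3 : s ≤ s') (h4 : η < |f s - f r|) :
    HasOsc f η s' (m + 1) := by
  obtain ⟨a, b, g1, g2, g3⟩ := H
  refine ⟨Fin.snoc (α := fun _ => ℝ) a r, Fin.snoc (α := fun _ => ℝ) b s, ?_, ?_, ?_⟩
  · intro i
    refine Fin.lastCases ?_ (fun j => ?_) i
    · simp only [Fin.snoc_last]
      exact ⟨ht.trans h1, h2, h3⟩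
    · simp only [Fin.snoc_castSucc]
      exact ⟨(g1 j).1, (g1 j).2.1, by linarith [(g1 j).2.2]⟩
  · intro i j
    refine Fin.lastCases ?_ (fun j' => ?_) j
    · refine Fin.lastCases ?_ (fun i' => ?_) i
      · intro hh; exact absurd hh (lt_irrefl _)
      · intro _
        simp only [Fin.snoc_last, Fin.snoc_castSucc]
        exact (g1 i').2.2.trans h1
    · refine Fin.lastCases ?_ (fun i' => ?_) i
      · intro hh; exact absurd hh (not_lt.mpr (Fin.le_last _))
      · intro hh
        simp only [Fin.snoc_castSucc]
        exact g2 i' j' (by simpa using hh)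
  · intro i
    refine Fin.lastCases ?_ (fun j => ?_) i
    · simpa only [Fin.snoc_last] using h4
    · simpa only [Fin.snoc_castSucc] using g3 j

lemma Regl.bdd {f : ℝ → ℝ} {q : ℝ} (hf : Regl f q) : ∃ M, ∀ s ∈ Set.Icc 0 q, |f s| ≤ M := by
  have key : ∃ M, ∀ s ∈ Set.Icc 0 q, s ∈ Set.Icc 0 q → |f s| ≤ M := by
    refine IsCompact.induction_on (p := fun S => ∃ M, ∀ s ∈ S, s ∈ Set.Icc 0 q → |f s| ≤ M)
      (isCompact_Icc (a := (0:ℝ)) (b := q)) ⟨0, by simp⟩ ?_ ?_ ?_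
    · rintro s t hst ⟨M, hM⟩
      exact ⟨M, fun x hx => hM x (hst hx)⟩
    · rintro s t ⟨M, hM⟩ ⟨M', hM'⟩
      refine ⟨max M M', fun x hx hq => ?_⟩
      rcases hx with hx | hx
      · exact (hM x hx hq).trans (le_max_left _ _)
      · exact (hM' x hx hq).trans (le_max_right _ _)
    · intro t ht
      obtain ⟨δ, hδ, H⟩ := hf t ht 1 one_pos
      refine ⟨Metric.ball t δ, mem_nhdsWithin_of_mem_nhds (Metric.ball_mem_nhds t hδ), ?_⟩
      have hL : ∃ M, ∀ s ∈ Set.Icc 0 q, |s - t| < δ → s < t → |f s| ≤ M := by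
        by_cases hex : ∃ r ∈ Set.Icc 0 q, |r - t| < δ ∧ r < t
        · obtain ⟨r, hr, hr1, hr2⟩ := hex
          refine ⟨|f r| + 1, fun s hs hs1 hs2 => ?_⟩
          have := H s hs r hr hs1 hr1 (Or.inl ⟨hs2, hr2⟩)
          have := abs_sub_abs_le_abs_sub (f s) (f r)
          linarith
        · push Not at hex
          exact ⟨0, fun s hs hs1 hs2 => absurd hs2 (not_lt.mpr (hex s hs hs1))⟩
      have hR : ∃ M, ∀ s ∈ Set.Icc 0 q, |s - t| < δ → t < s → |f s| ≤ M := by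
        by_cases hex : ∃ r ∈ Set.Icc 0 q, |r - t| < δ ∧ t < r
        · obtain ⟨r, hr, hr1, hr2⟩ := hex
          refine ⟨|f r| + 1, fun s hs hs1 hs2 => ?_⟩
          have := H s hs r hr hs1 hr1 (Or.inr ⟨hs2, hr2⟩)
          have := abs_sub_abs_le_abs_sub (f s) (f r)
          linarith
        · push Not at hex
          exact ⟨0, fun s hs hs1 hs2 => absurd hs2 (not_lt.mpr (hex s hs hs1))⟩
      obtain ⟨M1, h1⟩ := hL
      obtain ⟨M2, h2⟩ := hR
      refine ⟨max (max M1 M2) |f t|, fun s hs hsq => ?_⟩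
      rw [Metric.mem_ball, Real.dist_eq] at hs
      rcases lt_trichotomy s t with h | h | h
      · exact (h1 s hsq hs h).trans ((le_max_left _ _).trans (le_max_left _ _))
      · rw [h]; exact le_max_right _ _
      · exact (h2 s hsq hs h).trans ((le_max_right _ _).trans (le_max_left _ _))
  obtain ⟨M, hM⟩ := key
  exact ⟨M, fun s hs => hM s hs hs⟩

lemma Regl.osc {f : ℝ → ℝ} {q η : ℝ} (hf : Regl f q) (hη : 0 < η) {m : ℕ}
    (H : HasOsc f η q m) : m ≤ OscN f η q := by
  have key : ∃ M : ℕ, ∀ (m : ℕ) (a b : Fin m → ℝ),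
      (∀ i, 0 ≤ a i ∧ a i ≤ b i ∧ b i ≤ q) → (∀ i j, i < j → b i ≤ a j) →
      (∀ i, η < |f (b i) - f (a i)|) →
      {i | b i ∈ Set.Icc 0 q}.ncard ≤ M := by
    refine IsCompact.induction_on (p := fun S => ∃ M : ℕ, ∀ (m : ℕ) (a b : Fin m → ℝ),
      (∀ i, 0 ≤ a i ∧ a i ≤ b i ∧ b i ≤ q) → (∀ i j, i < j → b i ≤ a j) →
      (∀ i, η < |f (b i) - f (a i)|) →
      {i | b i ∈ S}.ncard ≤ M)
      (isCompact_Icc (a := (0:ℝ)) (b := q)) ⟨0, by simp⟩ ?_ ?_ ?_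
    · rintro s t hst ⟨M, hM⟩
      refine ⟨M, fun m a b h1 h2 h3 => le_trans ?_ (hM m a b h1 h2 h3)⟩
      exact Set.ncard_le_ncard (fun i hi => hst hi) (Set.toFinite _)
    · rintro s t ⟨M, hM⟩ ⟨M', hM'⟩
      refine ⟨M + M', fun m a b h1 h2 h3 => ?_⟩
      have : {i | b i ∈ s ∪ t} = {i | b i ∈ s} ∪ {i | b i ∈ t} := by ext; simp
      rw [this]
      exact (Set.ncard_union_le _ _).trans (add_le_add (hM m a b h1 h2 h3) (hM' m a b h1 h2 h3))
    · intro t ht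
      obtain ⟨δ, hδ, H⟩ := hf t ht η hη
      refine ⟨Metric.ball t δ, mem_nhdsWithin_of_mem_nhds (Metric.ball_mem_nhds t hδ), 3, ?_⟩
      intro m a b h1 h2 h3
      by_contra hcon
      push Not at hcon
      set S : Set (Fin m) := {i | b i ∈ Metric.ball t δ} with hS
      have hfin : S.Finite := Set.toFinite _
      have hcard : 4 ≤ hfin.toFinset.card := by
        rw [← Set.ncard_eq_toFinset_card S hfin]; exact hcon
      let e := hfin.toFinset.orderEmbOfCardLe hcard
      have he : ∀ j, |b (e j) - t| < δ := by
        intro j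
        have := Finset.orderEmbOfCardLe_mem hfin.toFinset hcard j
        rw [Set.Finite.mem_toFinset] at this
        have h' : b (e j) ∈ Metric.ball t δ := this
        rwa [Metric.mem_ball, Real.dist_eq] at h'
      have hlt : ∀ i j : Fin 4, i < j → e i < e j := fun i j hij => e.strictMono hij
      have hne : ∀ i, a i < b i := by
        intro i
        refine lt_of_le_of_ne (h1 i).2.1 fun heq => ?_
        have := h3 i
        rw [heq, sub_self, abs_zero] at this
        linarith
      have hmid : ∀ i j : Fin 4, i < j → a (e j) ≤ t ∧ t ≤ b (e j) := by
        intro i j hij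
        have hb := h2 _ _ (hlt i j hij)
        have hab := hne (e j)
        have hi := abs_lt.mp (he i)
        have hj := abs_lt.mp (he j)
        have haj : |a (e j) - t| < δ := abs_lt.mpr ⟨by linarith, by linarith⟩
        have hA : a (e j) ∈ Set.Icc 0 q := ⟨(h1 _).1, (h1 _).2.1.trans (h1 _).2.2⟩
        have hB : b (e j) ∈ Set.Icc 0 q := ⟨(h1 _).1.trans (h1 _).2.1, (h1 _).2.2⟩
        constructor
        · by_contra hc
          push Not at hc
          have := H _ hB _ hA (he j) haj (Or.inr ⟨by linarith, hc⟩)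
          linarith [h3 (e j)]
        · by_contra hc
          push Not at hc
          have := H _ hB _ hA (he j) haj (Or.inl ⟨hc, by linarith⟩)
          linarith [h3 (e j)]
      have q1 := hmid 0 1 (by decide)
      have q3 := hmid 0 3 (by decide)
      have r1 := h2 _ _ (hlt 1 2 (by decide))
      have r2 := h2 _ _ (hlt 2 3 (by decide))
      have r3 := hne (e 2)
      linarith [q1.2, q3.1]
  obtain ⟨M, hM⟩ := key
  refine le_csSup ⟨M, ?_⟩ H
  rintro m' ⟨a, b, h1, h2, h3⟩
  have := hM m' a b h1 h2 h3
  have hu : {i | b i ∈ Set.Icc 0 q} = Set.univ := by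
    ext i
    simp only [Set.mem_ofPred_eq, Set.mem_univ, iff_true]
    exact ⟨(h1 _).1.trans (h1 _).2.1, (h1 _).2.2⟩
  rw [hu, Set.ncard_univ] at this
  simpa using this

/-- Going from the lower barrier to the upper one forces an oscillation. -/
lemma crossing {x y k lb ub : ℝ → ℝ} {q η a b : ℝ} (hη : 0 < η) (ha : 0 ≤ a) (hab : a ≤ b)
    (hbq : b ≤ q) (hx : ∀ t ∈ Set.Icc 0 q, x t = y t + k t)
    (hgap : ∀ t ∈ Set.Icc 0 q, 6 * η ≤ ub t - lb t)
    (hk : ∀ t r : ℝ, 0 ≤ t → t ≤ r → r ≤ q → (∀ s, t < s → s ≤ r → lb s < x s) → k r ≤ k t)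
    (hj : ∀ t, 0 < t → t ≤ q → ∃ L, Tendsto k (𝓝[<] t) (𝓝 L) ∧ (lb t < x t → k t ≤ L))
    (hxa : x a = lb a) (hxb : x b = ub b) :
    ∃ r s, a ≤ r ∧ r ≤ s ∧ s ≤ b ∧ (η < |y s - y r| ∨ η < |lb s - lb r|) := by
  by_contra hcon
  push Not at hcon
  have hy : ∀ r s, a ≤ r → r ≤ s → s ≤ b → y s - y r ≤ η := fun r s h1 h2 h3 =>
    (le_abs_self _).trans (hcon r s h1 h2 h3).1
  have hl : ∀ s, a ≤ s → s ≤ b → |lb s - lb a| ≤ η := fun s h2 h3 => (hcon a s le_rfl h2 h3).2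
  set S : Set ℝ := {s | a ≤ s ∧ s ≤ b ∧ x s ≤ lb a + 2 * η} with hS
  have haS : a ∈ S := ⟨le_rfl, hab, by rw [hxa]; linarith⟩
  have hbdd : BddAbove S := ⟨b, fun s hs => hs.2.1⟩
  set σ := sSup S with hσ
  have haσ : a ≤ σ := le_csSup hbdd haS
  have hσb : σ ≤ b := csSup_le ⟨a, haS⟩ fun s hs => hs.2.1
  have habove : ∀ s, σ < s → s ≤ b → lb a + 2 * η < x s := by
    intro s h1 h2
    by_contra hc
    push Not at hc
    exact absurd (le_csSup hbdd (show s ∈ S from ⟨by linarith, h2, hc⟩)) (not_le.mpr h1)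
  have hkb : k b ≤ k σ := by
    refine hk σ b (ha.trans haσ) hσb hbq fun s h1 h2 => ?_
    have := habove s h1 h2
    have := (abs_le.mp (hl s (by linarith) h2)).2
    linarith
  have hxbq := hx b ⟨by linarith, hbq⟩
  have hlb := (abs_le.mp (hl b hab le_rfl)).1
  have hg := hgap b ⟨by linarith, hbq⟩
  by_cases hσS : σ ∈ S
  · have h1 := hx σ ⟨by linarith, by linarith⟩
    have h2 := hy σ b haσ hσb le_rfl
    have h3 := hσS.2.2
    linarith
  · have hσa : a < σ := lt_of_le_of_ne haσ fun h => hσS (h ▸ haS)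
    have hσx : lb a + 2 * η < x σ := by
      by_contra hc
      push Not at hc
      exact hσS ⟨haσ, hσb, hc⟩
    obtain ⟨L, hL, hL2⟩ := hj σ (by linarith) (by linarith)
    have hkL : k σ ≤ L := hL2 (by
      have := (abs_le.mp (hl σ haσ hσb)).2
      linarith)
    have hev : ∀ᶠ s in 𝓝[<] σ, L - η < k s := hL.eventually (lt_mem_nhds (by linarith))
    obtain ⟨c, hc, hc2⟩ := (mem_nhdsLT_iff_exists_Ioo_subset).mp hev
    obtain ⟨s, hsS, hs⟩ := exists_lt_of_lt_csSup ⟨a, haS⟩ (show c < sSup S from hc)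
    have hsσ : s < σ := lt_of_le_of_ne (le_csSup hbdd hsS) fun h => hσS (h ▸ hsS)
    have h0 : L - η < k s := hc2 ⟨hs, hsσ⟩
    have h1 := hx s ⟨by linarith [hsS.1], by linarith⟩
    have h2 := hy s b hsS.1 hsS.2.1 le_rfl
    have h3 := hsS.2.2
    linarith

/-- Total count of oscillations of three functions. -/
def Good (y lb ub : ℝ → ℝ) (η t : ℝ) (n : ℕ) : Prop :=
  ∃ m1 m2 m3 : ℕ, n = m1 + m2 + m3 ∧ HasOsc y η t m1 ∧ HasOsc lb η t m2 ∧ HasOsc ub η t m3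

/-- The deterministic variation estimate along a partition. -/
lemma det_bound {x y k lb ub : ℝ → ℝ} {q η S : ℝ} (hη : 0 < η)
    (hx : ∀ t ∈ Set.Icc 0 q, x t = y t + k t)
    (hgap : ∀ t ∈ Set.Icc 0 q, 6 * η ≤ ub t - lb t)
    (hxl : ∀ t ∈ Set.Icc 0 q, lb t ≤ x t) (hxu : ∀ t ∈ Set.Icc 0 q, x t ≤ ub t)
    (hk : ∀ t r : ℝ, 0 ≤ t → t ≤ r → r ≤ q → (∀ s, t < s → s ≤ r → lb s < x s) → k r ≤ k t)
    (hk' : ∀ t r : ℝ, 0 ≤ t → t ≤ r → r ≤ q → (∀ s, t < s → s ≤ r → x s < ub s) → k t ≤ k r)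
    (hj : ∀ t, 0 < t → t ≤ q → ∃ L, Tendsto k (𝓝[<] t) (𝓝 L) ∧ (lb t < x t → k t ≤ L) ∧
      (x t < ub t → L ≤ k t))
    (hS : ∀ t ∈ Set.Icc 0 q, |k t| ≤ S)
    (u : ℕ → ℝ) (hu : Monotone u) (huq : ∀ i, u i ∈ Set.Icc 0 q) (n : ℕ) :
    ∃ m, Good y lb ub η q m ∧
      ∑ i ∈ Finset.range n, |k (u (i + 1)) - k (u i)| ≤ 2 * S * (m + 1) := by
  have crossUp : ∀ (a b : ℝ) (m : ℕ), 0 ≤ a → a ≤ b → b ≤ q → x a = lb a → x b = ub b →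
      Good y lb ub η a m → Good y lb ub η b (m + 1) := by
    rintro a b m ha hab hb h1 h2 ⟨m1, m2, m3, rfl, g1, g2, g3⟩
    obtain ⟨r, s, har, hrs, hsb, h | h⟩ := crossing hη ha hab hb hx hgap hk
      (fun t ht htq => by
        obtain ⟨L, p1, p2, p3⟩ := hj t ht htq
        exact ⟨L, p1, p2⟩) h1 h2
    · exact ⟨m1 + 1, m2, m3, by ring, g1.succ ha har hrs hsb h, g2.mono hab, g3.mono hab⟩
    · exact ⟨m1, m2 + 1, m3, by ring, g1.mono hab, g2.succ ha har hrs hsb h, g3.mono hab⟩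
  have crossDown : ∀ (a b : ℝ) (m : ℕ), 0 ≤ a → a ≤ b → b ≤ q → x a = ub a → x b = lb b →
      Good y lb ub η a m → Good y lb ub η b (m + 1) := by
    rintro a b m ha hab hb h1 h2 ⟨m1, m2, m3, rfl, g1, g2, g3⟩
    obtain ⟨r, s, har, hrs, hsb, h⟩ := crossing (x := fun t => - x t) (y := fun t => - y t)
      (k := fun t => - k t) (lb := fun t => - ub t) (ub := fun t => - lb t) hη ha hab hb
      (fun t ht => by rw [hx t ht]; ring)
      (fun t ht => by have := hgap t ht; linarith)
      (fun t r h1 h2 h3 h4 => by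
        have := hk' t r h1 h2 h3 (fun s p1 p2 => by have := h4 s p1 p2; linarith)
        linarith)
      (fun t ht htq => by
        obtain ⟨L, p1, p2, p3⟩ := hj t ht htq
        exact ⟨-L, p1.neg, fun h => by
          have := p3 (by linarith)
          linarith⟩) (by rw [h1]) (by rw [h2])
    have e : ∀ f : ℝ → ℝ, |-f s - -f r| = |f s - f r| := fun f => by
      rw [show -f s - -f r = -(f s - f r) by ring, abs_neg]
    rw [e, e] at h
    rcases h with h | h
    · exact ⟨m1 + 1, m2, m3, by ring, g1.succ ha har hrs hsb h, g2.mono hab, g3.mono hab⟩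
    · exact ⟨m1, m2, m3 + 1, by ring, g1.mono hab, g2.mono hab, g3.succ ha har hrs hsb h⟩
  have good0 : ∀ t, Good y lb ub η t 0 := fun t =>
    ⟨0, 0, 0, rfl, hasOsc_zero _ _ _, hasOsc_zero _ _ _, hasOsc_zero _ _ _⟩
  have inv : ∀ n : ℕ,
      (∑ i ∈ Finset.range n, |k (u (i + 1)) - k (u i)| = 0) ∨
      (∃ (m : ℕ) (t v : ℝ), 0 ≤ t ∧ t ≤ u n ∧ x t = lb t ∧ Good y lb ub η t m ∧ |v| ≤ S ∧
        ∑ i ∈ Finset.range n, |k (u (i + 1)) - k (u i)| ≤ 2 * S * m + (k (u n) - v)) ∨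
      (∃ (m : ℕ) (t v : ℝ), 0 ≤ t ∧ t ≤ u n ∧ x t = ub t ∧ Good y lb ub η t m ∧ |v| ≤ S ∧
        ∑ i ∈ Finset.range n, |k (u (i + 1)) - k (u i)| ≤ 2 * S * m + (v - k (u n))) := by
    intro n
    induction n with
    | zero => left; simp
    | succ n ih =>
      rw [Finset.sum_range_succ]
      have hun := hu (Nat.le_succ n)
      rw [Nat.succ_eq_add_one] at hun
      have hq0 := huq n
      have hq1 := huq (n + 1)
      have hSn := hS _ hq0
      have hSn' := abs_le.mp hSn
      rcases lt_trichotomy (k (u (n + 1))) (k (u n)) with hd | hd | hd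
      · -- decrease: touch of the upper barrier
        obtain ⟨s, hs1, hs2, hs3⟩ : ∃ s, u n < s ∧ s ≤ u (n + 1) ∧ x s = ub s := by
          by_contra hc
          push Not at hc
          have := hk' (u n) (u (n + 1)) hq0.1 hun hq1.2 (fun s p1 p2 =>
            lt_of_le_of_ne (hxu s ⟨by linarith [hq0.1], by linarith [hq1.2]⟩) (hc s p1 p2))
          linarith
        have hs0 : 0 ≤ s := by linarith [hq0.1]
        have habs : |k (u (n + 1)) - k (u n)| = k (u n) - k (u (n + 1)) := by
          rw [abs_of_neg (by linarith)]; ring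
        rw [habs]
        right; right
        rcases ih with h | ⟨m, t, v, h1, h2, h3, h4, h5, h6⟩ | ⟨m, t, v, h1, h2, h3, h4, h5, h6⟩
        · exact ⟨0, s, k (u n), hs0, hs2, hs3, good0 _, hSn, by rw [h]; simp⟩
        · refine ⟨m + 1, s, k (u n), hs0, hs2, hs3,
            crossUp t s m h1 (by linarith) (by linarith [hq1.2]) h3 hs3 h4, hSn, ?_⟩
          have := abs_le.mp h5
          push_cast
          linarith
        · exact ⟨m, t, v, h1, by linarith, h3, h4, h5, by linarith⟩
      · rw [hd, sub_self, abs_zero, add_zero]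
        rcases ih with h | ⟨m, t, v, h1, h2, h⟩ | ⟨m, t, v, h1, h2, h⟩
        · exact Or.inl h
        · exact Or.inr (Or.inl ⟨m, t, v, h1, h2.trans hun, h⟩)
        · exact Or.inr (Or.inr ⟨m, t, v, h1, h2.trans hun, h⟩)
      · obtain ⟨s, hs1, hs2, hs3⟩ : ∃ s, u n < s ∧ s ≤ u (n + 1) ∧ x s = lb s := by
          by_contra hc
          push Not at hc
          have := hk (u n) (u (n + 1)) hq0.1 hun hq1.2 (fun s p1 p2 =>
            lt_of_le_of_ne (hxl s ⟨by linarith [hq0.1], by linarith [hq1.2]⟩) (hc s p1 p2).symm)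
          linarith
        have hs0 : 0 ≤ s := by linarith [hq0.1]
        have habs : |k (u (n + 1)) - k (u n)| = k (u (n + 1)) - k (u n) :=
          abs_of_pos (by linarith)
        rw [habs]
        right; left
        rcases ih with h | ⟨m, t, v, h1, h2, h3, h4, h5, h6⟩ | ⟨m, t, v, h1, h2, h3, h4, h5, h6⟩
        · exact ⟨0, s, k (u n), hs0, hs2, hs3, good0 _, hSn, by rw [h]; simp⟩
        · exact ⟨m, t, v, h1, by linarith, h3, h4, h5, by linarith⟩
        · refine ⟨m + 1, s, k (u n), hs0, hs2, hs3,
            crossDown t s m h1 (by linarith) (by linarith [hq1.2]) h3 hs3 h4, hSn, ?_⟩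
          have := abs_le.mp h5
          push_cast
          linarith
  have hSn := abs_le.mp (hS _ (huq n))
  have gm : ∀ t m, t ≤ u n → Good y lb ub η t m → Good y lb ub η q m := by
    rintro t m ht ⟨m1, m2, m3, e, g1, g2, g3⟩
    have := ht.trans (huq n).2
    exact ⟨m1, m2, m3, e, g1.mono this, g2.mono this, g3.mono this⟩
  rcases inv n with h | ⟨m, t, v, h1, h2, h3, h4, h5, h6⟩ | ⟨m, t, v, h1, h2, h3, h4, h5, h6⟩
  · refine ⟨0, good0 _, ?_⟩
    rw [h]
    have := (abs_nonneg _).trans (hS _ (huq n))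
    push_cast
    linarith
  · refine ⟨m, gm t m h2 h4, ?_⟩
    have := abs_le.mp h5
    linarith
  · refine ⟨m, gm t m h2 h4, ?_⟩
    have := abs_le.mp h5
    linarith

lemma l1_cauchy {Ω : Type*} [MeasurableSpace Ω] {μ : Measure Ω} [IsProbabilityMeasure μ]
    {Y : ℝ → Ω → ℝ} (hY : NiceProcess μ Y) {q : ℝ} (hq : 0 ≤ q) (F : Filter ℝ)
    [F.IsCountablyGenerated] (hF : ∀ᶠ s in F, s ∈ Set.Icc 0 q)
    (hlim : ∀ ω, ∃ L, Tendsto (fun s => Y s ω) F (𝓝 L)) :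
    Tendsto (fun p : ℝ × ℝ => ∫ ω, |Y p.1 ω - Y p.2 ω| ∂μ) (F ×ˢ F) (𝓝 0) := by
  refine tendsto_of_seq_tendsto fun p hp => ?_
  have hp1 : Tendsto (fun n => (p n).1) atTop F := tendsto_fst.comp hp
  have hp2 : Tendsto (fun n => (p n).2) atTop F := tendsto_snd.comp hp
  let a : ℕ → Set.Icc (0:ℝ) q := fun n => Set.projIcc 0 q hq (p n).1
  let b : ℕ → Set.Icc (0:ℝ) q := fun n => Set.projIcc 0 q hq (p n).2
  have ha : ∀ᶠ n in atTop, (a n : ℝ) = (p n).1 := by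
    filter_upwards [hp1.eventually hF] with n hn
    simp only [a]
    rw [Set.projIcc_of_mem hq hn]
  have hb : ∀ᶠ n in atTop, (b n : ℝ) = (p n).2 := by
    filter_upwards [hp2.eventually hF] with n hn
    simp only [b]
    rw [Set.projIcc_of_mem hq hn]
  have hU := hY.unifInt q hq
  have hUa : UnifIntegrable (fun n => Y (a n)) 1 μ := fun ε hε => by
    obtain ⟨δ, h1, h2⟩ := hU.2.1 hε
    exact ⟨δ, h1, fun i => h2 (a i)⟩
  have hUb : UnifIntegrable (fun n => Y (b n)) 1 μ := fun ε hε => by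
    obtain ⟨δ, h1, h2⟩ := hU.2.1 hε
    exact ⟨δ, h1, fun i => h2 (b i)⟩
  have hma : ∀ n, AEStronglyMeasurable (Y (a n)) μ := fun n => hU.1 (a n)
  have hmb : ∀ n, AEStronglyMeasurable (Y (b n)) μ := fun n => hU.1 (b n)
  have hsub := hUa.sub hUb le_rfl hma hmb
  have hT := tendsto_Lp_finite_of_tendsto_ae (μ := μ) (p := 1) le_rfl ENNReal.one_ne_top
    (f := (fun n => Y (a n)) - (fun n => Y (b n))) (g := fun _ => (0:ℝ))
    (fun n => (hma n).sub (hmb n)) MemLp.zero hsub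
    (Filter.Eventually.of_forall fun ω => by
      obtain ⟨L, hL⟩ := hlim ω
      have := (hL.comp hp1).sub (hL.comp hp2)
      rw [sub_self] at this
      refine this.congr' ?_
      filter_upwards [ha, hb] with n h1 h2
      simp [h1, h2])
  have hT2 := (ENNReal.tendsto_toReal ENNReal.zero_ne_top).comp hT
  rw [ENNReal.toReal_zero] at hT2
  refine hT2.congr' ?_
  filter_upwards [ha, hb] with n h1 h2
  have hm : AEStronglyMeasurable (fun ω => Y (p n).1 ω - Y (p n).2 ω) μ := by
    have := (hma n).sub (hmb n)
    rw [h1, h2] at this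
    exact this
  have e := integral_norm_eq_lintegral_enorm hm
  simp only [Real.norm_eq_abs] at e
  simp only [Function.comp]
  rw [e]
  simp only [eLpNorm_one_eq_lintegral_enorm]
  simp [h1, h2]

/-- A function dominated by the increments of a càdlàg function, of time and of the process is
one-sided Cauchy everywhere. -/
lemma regl_of_bound {Ω : Type*} [MeasurableSpace Ω] {μ : Measure Ω} [IsProbabilityMeasure μ]
    {Y : ℝ → Ω → ℝ} (hY : NiceProcess μ Y) {q : ℝ} (hq : 0 ≤ q) {g f : ℝ → ℝ} (hg : CadlagOn g)
    {c A B : ℝ} (hc : 0 < c)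
    (hb : ∀ s r, 0 ≤ s → 0 ≤ r →
      c * |f s - f r| ≤ |g s - g r| + A * |s - r| + B * ∫ ω, |Y s ω - Y r ω| ∂μ) :
    Regl f q := by
  have main : ∀ F : Filter ℝ, F.IsCountablyGenerated → (∀ᶠ s in F, s ∈ Set.Icc 0 q) →
      (∀ ω, ∃ L, Tendsto (fun s => Y s ω) F (𝓝 L)) → (∃ L, Tendsto g F (𝓝 L)) →
      (∃ t, Tendsto (fun s : ℝ => s) F (𝓝 t)) → ∀ ε : ℝ, 0 < ε →
      ∃ U ∈ F, ∀ s ∈ U, ∀ r ∈ U, |f s - f r| < ε := by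
    intro F _ hF h1 h2 h3 ε hε
    have t1 := l1_cauchy hY hq F hF h1
    obtain ⟨L, hL⟩ := h2
    obtain ⟨t, ht⟩ := h3
    have t2 := ((hL.comp tendsto_fst).sub (hL.comp (tendsto_snd (f := F) (g := F)))).abs
    have t3 := ((ht.comp tendsto_fst).sub (ht.comp (tendsto_snd (f := F) (g := F)))).abs
    have t4 := (t2.add (t3.const_mul A)).add (t1.const_mul B)
    simp only [sub_self, abs_zero, mul_zero, add_zero] at t4
    have ev := t4.eventually (gt_mem_nhds (show (0:ℝ) < c * ε by positivity))
    have hFF : ∀ᶠ p in F ×ˢ F, p.1 ∈ Set.Icc 0 q ∧ p.2 ∈ Set.Icc 0 q := hF.prod_mk hF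
    have ev2 : ∀ᶠ p in F ×ˢ F, |f p.1 - f p.2| < ε := by
      filter_upwards [ev, hFF] with p h1 h2
      have := hb p.1 p.2 h2.1.1 h2.2.1
      simp only [Function.comp] at h1
      exact lt_of_mul_lt_mul_left (lt_of_le_of_lt this h1) hc.le
    obtain ⟨U, hU, hU2⟩ := mem_prod_self_iff.mp ev2
    exact ⟨U, hU, fun s hs r hr => hU2 (Set.mk_mem_prod hs hr)⟩
  intro t ht ε hε
  have left : ∃ U ∈ 𝓝[Set.Iio t ∩ Set.Icc 0 q] t, ∀ s ∈ U, ∀ r ∈ U, |f s - f r| < ε := by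
    rcases eq_or_lt_of_le ht.1 with h0 | h0
    · refine ⟨∅, ?_, by simp⟩
      have : Set.Iio t ∩ Set.Icc 0 q = ∅ := by
        ext s
        simp only [Set.mem_inter_iff, Set.mem_Iio, Set.mem_Icc, Set.mem_empty_iff_false, iff_false]
        rintro ⟨h1, h2, -⟩
        linarith
      rw [this, nhdsWithin_empty]
      exact Filter.mem_bot
    · have hle : 𝓝[Set.Iio t ∩ Set.Icc 0 q] t ≤ 𝓝[<] t := nhdsWithin_mono _ Set.inter_subset_left
      refine main _ inferInstance ?_ ?_ ?_ ⟨t, tendsto_id.mono_left nhdsWithin_le_nhds⟩ ε hε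
      · filter_upwards [self_mem_nhdsWithin] with s hs using hs.2
      · intro ω
        obtain ⟨L, hL⟩ := (hY.cadlag ω).2 t h0
        exact ⟨L, hL.mono_left hle⟩
      · obtain ⟨L, hL⟩ := hg.2 t h0
        exact ⟨L, hL.mono_left hle⟩
  have right : ∃ U ∈ 𝓝[Set.Ici t ∩ Set.Icc 0 q] t, ∀ s ∈ U, ∀ r ∈ U, |f s - f r| < ε := by
    have hle : 𝓝[Set.Ici t ∩ Set.Icc 0 q] t ≤ 𝓝[≥] t := nhdsWithin_mono _ Set.inter_subset_left
    refine main _ inferInstance ?_ ?_ ?_ ⟨t, tendsto_id.mono_left nhdsWithin_le_nhds⟩ ε hε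
    · filter_upwards [self_mem_nhdsWithin] with s hs using hs.2
    · intro ω
      exact ⟨_, ((hY.cadlag ω).1 t ht.1).mono_left hle⟩
    · exact ⟨_, (hg.1 t ht.1).mono_left hle⟩
  obtain ⟨U, hU, hU2⟩ := left
  obtain ⟨V, hV, hV2⟩ := right
  obtain ⟨δ1, hδ1, h1⟩ := Metric.mem_nhdsWithin_iff.mp hU
  obtain ⟨δ2, hδ2, h2⟩ := Metric.mem_nhdsWithin_iff.mp hV
  refine ⟨min δ1 δ2, lt_min hδ1 hδ2, fun s hs r hr hsd hrd hor => ?_⟩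
  rcases hor with ⟨p1, p2⟩ | ⟨p1, p2⟩
  · refine hU2 s (h1 ⟨?_, p1, hs⟩) r (h1 ⟨?_, p2, hr⟩)
    · rw [Metric.mem_ball, Real.dist_eq]; exact hsd.trans_le (min_le_left _ _)
    · rw [Metric.mem_ball, Real.dist_eq]; exact hrd.trans_le (min_le_left _ _)
  · refine hV2 s (h2 ⟨?_, p1.le, hs⟩) r (h2 ⟨?_, p2.le, hr⟩)
    · rw [Metric.mem_ball, Real.dist_eq]; exact hsd.trans_le (min_le_right _ _)
    · rw [Metric.mem_ball, Real.dist_eq]; exact hrd.trans_le (min_le_right _ _)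

lemma integrable_h {Ω : Type*} [MeasurableSpace Ω] {μ : Measure Ω} [IsProbabilityMeasure μ]
    {h : ℝ → ℝ → ℝ} {Mh Lh ch Ch : ℝ} (hH : CondH h Mh Lh ch Ch) {Z : Ω → ℝ}
    (hZ : Integrable Z μ) {t : ℝ} (ht : 0 ≤ t) : Integrable (fun ω => h t (Z ω)) μ := by
  have hm : Measurable (h t) := hH.meas.of_uncurry_left
  refine Integrable.mono' (g := fun ω => Mh * (1 + |Z ω|))
    (((integrable_const 1).add hZ.abs).const_mul Mh)
    (hm.comp_aemeasurable hZ.aemeasurable).aestronglyMeasurable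
    (Filter.Eventually.of_forall fun ω => ?_)
  rw [Real.norm_eq_abs]
  exact hH.growth t _ ht

lemma h_lower {h : ℝ → ℝ → ℝ} {Mh Lh ch Ch : ℝ} (hH : CondH h Mh Lh ch Ch) {t z z' : ℝ}
    (ht : 0 ≤ t) (hz : z ≤ z') : ch * (z' - z) ≤ h t z' - h t z := by
  have h1 := hH.lip_lower t z' z ht
  have h2 := (hH.strict_mono t ht).monotone hz
  rwa [abs_of_nonneg (by linarith), abs_of_nonneg (by linarith)] at h1

lemma mean_lower {Ω : Type*} [MeasurableSpace Ω] {μ : Measure Ω} [IsProbabilityMeasure μ]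
    {h : ℝ → ℝ → ℝ} {Mh Lh ch Ch : ℝ} (hH : CondH h Mh Lh ch Ch) {Z : Ω → ℝ}
    (hZ : Integrable Z μ) {t : ℝ} (ht : 0 ≤ t) {z z' : ℝ} (hz : z ≤ z') :
    ch * (z' - z) ≤ (∫ ω, h t (Z ω + z') ∂μ) - ∫ ω, h t (Z ω + z) ∂μ := by
  have i1 := integrable_h hH (hZ.add (integrable_const z')) ht
  have i2 := integrable_h hH (hZ.add (integrable_const z)) ht
  simp only [Pi.add_apply] at i1 i2
  rw [← integral_sub i1 i2]
  have : ch * (z' - z) = ∫ _ω : Ω, ch * (z' - z) ∂μ := by simp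
  rw [this]
  refine integral_mono (integrable_const _) (i1.sub i2) fun ω => ?_
  have := h_lower hH ht (show Z ω + z ≤ Z ω + z' by linarith)
  simpa using this

lemma mean_abs_lower {Ω : Type*} [MeasurableSpace Ω] {μ : Measure Ω} [IsProbabilityMeasure μ]
    {h : ℝ → ℝ → ℝ} {Mh Lh ch Ch : ℝ} (hH : CondH h Mh Lh ch Ch) {Z : Ω → ℝ}
    (hZ : Integrable Z μ) {t : ℝ} (ht : 0 ≤ t) (z z' : ℝ) :
    ch * |z - z'| ≤ |(∫ ω, h t (Z ω + z) ∂μ) - ∫ ω, h t (Z ω + z') ∂μ| := by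
  rcases le_total z z' with hz | hz
  · have := mean_lower hH hZ ht hz
    rw [abs_sub_comm, abs_of_nonneg (sub_nonneg.mpr hz), abs_sub_comm]
    exact this.trans (le_abs_self _)
  · have := mean_lower hH hZ ht hz
    rw [abs_of_nonneg (sub_nonneg.mpr hz)]
    exact this.trans (le_abs_self _)

lemma mean_diff {Ω : Type*} [MeasurableSpace Ω] {μ : Measure Ω} [IsProbabilityMeasure μ]
    {Y : ℝ → Ω → ℝ} (hY : NiceProcess μ Y) {s r : ℝ} (hs : 0 ≤ s) (hr : 0 ≤ r) :
    |(∫ ω, Y s ω ∂μ) - ∫ ω, Y r ω ∂μ| ≤ ∫ ω, |Y s ω - Y r ω| ∂μ := by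
  rw [← integral_sub (hY.integrable s hs) (hY.integrable r hr)]
  exact abs_integral_le_integral_abs

lemma bar_bound {Ω : Type*} [MeasurableSpace Ω] {μ : Measure Ω} [IsProbabilityMeasure μ]
    {h : ℝ → ℝ → ℝ} {Mh Lh ch Ch : ℝ} (hH : CondH h Mh Lh ch Ch)
    {Y : ℝ → Ω → ℝ} (hY : NiceProcess μ Y) {l lbar : ℝ → ℝ}
    (hlbar : ∀ t : ℝ, 0 ≤ t → (∫ ω, h t (Y t ω - (∫ ω', Y t ω' ∂μ) + lbar t) ∂μ) = l t)
    (s r : ℝ) (hs : 0 ≤ s) (hr : 0 ≤ r) :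
    ch * |lbar s - lbar r| ≤ |l s - l r| + Lh * |s - r| +
      2 * Ch * ∫ ω, |Y s ω - Y r ω| ∂μ := by
  set ys := ∫ ω', Y s ω' ∂μ with hys
  set yr := ∫ ω', Y r ω' ∂μ with hyr
  have is : Integrable (fun ω => Y s ω - ys) μ := (hY.integrable s hs).sub (integrable_const _)
  have ir : Integrable (fun ω => Y r ω - yr) μ := (hY.integrable r hr).sub (integrable_const _)
  have hd := mean_diff hY hs hr
  rw [← hys, ← hyr] at hd
  have h1 := mean_abs_lower hH is hs (lbar s) (lbar r)
  have e1 := hlbar s hs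
  have e2 := hlbar r hr
  rw [← hys] at e1
  rw [← hyr] at e2
  rw [e1] at h1
  have j1 : Integrable (fun ω => h s (Y s ω - ys + lbar r)) μ :=
    integrable_h hH (is.add (integrable_const (lbar r))) hs
  have j2 : Integrable (fun ω => h r (Y r ω - yr + lbar r)) μ :=
    integrable_h hH (ir.add (integrable_const (lbar r))) hr
  have iD : Integrable (fun ω => |Y s ω - Y r ω|) μ :=
    ((hY.integrable s hs).sub (hY.integrable r hr)).abs
  have h2 : |(∫ ω, h s (Y s ω - ys + lbar r) ∂μ) - l r| ≤
      Lh * |s - r| + Ch * ((∫ ω, |Y s ω - Y r ω| ∂μ) + |ys - yr|) := by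
    rw [← e2, ← integral_sub j1 j2]
    refine abs_integral_le_integral_abs.trans ?_
    have : Lh * |s - r| + Ch * ((∫ ω, |Y s ω - Y r ω| ∂μ) + |ys - yr|) =
        ∫ ω, (Lh * |s - r| + Ch * (|Y s ω - Y r ω| + |ys - yr|)) ∂μ := by
      have iD2 : Integrable (fun ω => |Y s ω - Y r ω| + |ys - yr|) μ :=
        iD.add (integrable_const _)
      rw [integral_add (integrable_const _) (iD2.const_mul Ch),
        integral_const_mul, integral_const_mul, integral_add iD (integrable_const _)]
      simp
    rw [this]
    refine integral_mono (j1.sub j2).abs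
      ((integrable_const _).add ((iD.add (integrable_const _)).const_mul Ch)) fun ω => ?_
    have a1 := hH.lip_upper s (Y s ω - ys + lbar r) (Y r ω - yr + lbar r) hs
    have a2 := hH.lip_time r s (Y r ω - yr + lbar r) hr hs
    have a3 : |Y s ω - ys + lbar r - (Y r ω - yr + lbar r)| ≤ |Y s ω - Y r ω| + |ys - yr| := by
      rw [show Y s ω - ys + lbar r - (Y r ω - yr + lbar r) = (Y s ω - Y r ω) - (ys - yr) by ring]
      exact abs_sub _ _
    have a4 := mul_le_mul_of_nonneg_left a3 hH.Ch_pos.le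
    have a5 := abs_sub_le (h s (Y s ω - ys + lbar r)) (h s (Y r ω - yr + lbar r))
      (h r (Y r ω - yr + lbar r))
    linarith
  have h3 := abs_sub_le (l s) (l r) (∫ ω, h s (Y s ω - ys + lbar r) ∂μ)
  rw [abs_sub_comm (l r)] at h3
  have h4 := mul_le_mul_of_nonneg_left hd hH.Ch_pos.le
  linarith

/-- bound on the total variation of `k` on `[0,q]` in terms of the numbers of
`η`-oscillations of `y = E Y`, `l̄` and `ū`. -/
theorem stmt_11 {Ω : Type*} [MeasurableSpace Ω] (μ : Measure Ω) [IsProbabilityMeasure μ]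
    (h : ℝ → ℝ → ℝ) (Mh Lh ch Ch : ℝ) (hH : CondH h Mh Lh ch Ch)
    (Y : ℝ → Ω → ℝ) (hY : NiceProcess μ Y)
    (l u : ℝ → ℝ) (hl : CadlagOn l) (hu : CadlagOn u)
    (hlu : ∀ t : ℝ, 0 ≤ t → l t ≤ u t)
    (h0 : (∫ ω, h 0 (Y 0 ω) ∂μ) ∈ Set.Icc (l 0) (u 0))
    (lbar ubar : ℝ → ℝ)
    (hlbar : ∀ t : ℝ, 0 ≤ t → (∫ ω, h t (Y t ω - (∫ ω', Y t ω' ∂μ) + lbar t) ∂μ) = l t)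
    (hubar : ∀ t : ℝ, 0 ≤ t → (∫ ω, h t (Y t ω - (∫ ω', Y t ω' ∂μ) + ubar t) ∂μ) = u t)
    (X : ℝ → Ω → ℝ) (k : ℝ → ℝ) (hsol : MeanSP μ h Y l u X k)
    (q η : ℝ) (hq : 0 ≤ q) (hη : 0 < η)
    (hη2 : 2 * η ≤ sInf ((fun s => ubar s - lbar s) '' Set.Icc 0 q) / 3) :
    eVariationOn k (Set.Icc 0 q) ≤ ENNReal.ofReal
      (6 * ((OscN (fun s => ∫ ω, Y s ω ∂μ) η q : ℝ) + (OscN lbar η q : ℝ) +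
          (OscN ubar η q : ℝ) + 1) *
        (sSup ((fun s => |∫ ω, Y s ω ∂μ|) '' Set.Icc 0 q) +
          sSup ((fun s => max |lbar s| |ubar s|) '' Set.Icc 0 q))) := by
  obtain ⟨hXc, hkc, hk0, hXY, hXlu, hmin, hjump⟩ := hsol
  set y : ℝ → ℝ := fun s => ∫ ω, Y s ω ∂μ with hy
  have rl : Regl lbar q := regl_of_bound hY hq hl hH.ch_pos (bar_bound hH hY hlbar)
  have ru : Regl ubar q := regl_of_bound hY hq hu hH.ch_pos (bar_bound hH hY hubar)
  have ry : Regl y q := by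
    refine regl_of_bound hY hq hl (c := 1) (A := 0) (B := 1) one_pos fun s r hs hr => ?_
    have := mean_diff hY hs hr
    have := abs_nonneg (l s - l r)
    simp only [hy]
    linarith
  -- the centred process
  have hEq : ∀ t, 0 ≤ t → (∫ ω, h t (X t ω) ∂μ) =
      ∫ ω, h t (Y t ω - (∫ ω', Y t ω' ∂μ) + (y t + k t)) ∂μ := by
    intro t ht
    congr 1
    ext ω
    rw [hXY t ht ω]
    congr 1
    simp only [hy]
    ring
  have hZ : ∀ t, 0 ≤ t → Integrable (fun ω => Y t ω - (∫ ω', Y t ω' ∂μ)) μ := fun t ht =>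
    (hY.integrable t ht).sub (integrable_const _)
  have hcmp : ∀ t, 0 ≤ t → ∀ z z' : ℝ,
      ((∫ ω, h t (Y t ω - (∫ ω', Y t ω' ∂μ) + z) ∂μ) <
        ∫ ω, h t (Y t ω - (∫ ω', Y t ω' ∂μ) + z') ∂μ) ↔ z < z' := by
    intro t ht z z'
    constructor
    · intro hh
      by_contra hc
      push Not at hc
      have h1 := mean_lower hH (hZ t ht) ht hc
      have h2 := mul_nonneg hH.ch_pos.le (sub_nonneg.mpr hc)
      linarith
    · intro hh
      have h1 := mean_lower hH (hZ t ht) ht hh.le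
      have h2 := mul_pos hH.ch_pos (sub_pos.mpr hh)
      linarith
  have hUlt : ∀ t, 0 ≤ t → ((∫ ω, h t (X t ω) ∂μ) < u t ↔ y t + k t < ubar t) := by
    intro t ht
    rw [hEq t ht, ← hubar t ht]
    exact hcmp t ht _ _
  have hLlt : ∀ t, 0 ≤ t → (l t < (∫ ω, h t (X t ω) ∂μ) ↔ lbar t < y t + k t) := by
    intro t ht
    rw [hEq t ht, ← hlbar t ht]
    exact hcmp t ht _ _
  have hxl : ∀ t, 0 ≤ t → lbar t ≤ y t + k t := by
    intro t ht
    by_contra hc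
    push Not at hc
    have h1 := (hcmp t ht _ _).mpr hc
    rw [← hEq t ht, hlbar t ht] at h1
    linarith [(hXlu t ht).1]
  have hxu : ∀ t, 0 ≤ t → y t + k t ≤ ubar t := by
    intro t ht
    by_contra hc
    push Not at hc
    have h1 := (hcmp t ht _ _).mpr hc
    rw [← hEq t ht, hubar t ht] at h1
    linarith [(hXlu t ht).2]
  obtain ⟨My, hMy⟩ := ry.bdd
  obtain ⟨Ml, hMl⟩ := rl.bdd
  obtain ⟨Mu, hMu⟩ := ru.bdd
  set S1 := sSup ((fun s => |y s|) '' Set.Icc 0 q) with hS1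
  set S2 := sSup ((fun s => max |lbar s| |ubar s|) '' Set.Icc 0 q) with hS2
  have b1 : ∀ t ∈ Set.Icc 0 q, |y t| ≤ S1 := fun t ht =>
    le_csSup ⟨My, by rintro _ ⟨s, hs, rfl⟩; exact hMy s hs⟩ ⟨t, ht, rfl⟩
  have b2 : ∀ t ∈ Set.Icc 0 q, max |lbar t| |ubar t| ≤ S2 := fun t ht =>
    le_csSup ⟨max Ml Mu, by
      rintro _ ⟨s, hs, rfl⟩
      exact max_le_max (hMl s hs) (hMu s hs)⟩ ⟨t, ht, rfl⟩
  have hkS : ∀ t ∈ Set.Icc 0 q, |k t| ≤ S1 + S2 := by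
    intro t ht
    have c1 := abs_le.mp (b1 t ht)
    have c2 := abs_le.mp ((le_max_left _ _).trans (b2 t ht))
    have c3 := abs_le.mp ((le_max_right _ _).trans (b2 t ht))
    have c4 := hxl t ht.1
    have c5 := hxu t ht.1
    exact abs_le.mpr ⟨by linarith, by linarith⟩
  have hgap : ∀ t ∈ Set.Icc 0 q, 6 * η ≤ ubar t - lbar t := by
    intro t ht
    have : sInf ((fun s => ubar s - lbar s) '' Set.Icc 0 q) ≤ ubar t - lbar t := by
      refine csInf_le ⟨-Mu - Ml, ?_⟩ ⟨t, ht, rfl⟩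
      rintro _ ⟨s, hs, rfl⟩
      have c2 := abs_le.mp (hMl s hs)
      have c3 := abs_le.mp (hMu s hs)
      simp only
      linarith
    linarith
  have hS0 : 0 ≤ S1 + S2 := (abs_nonneg _).trans (hkS 0 ⟨le_rfl, hq⟩)
  refine iSup_le ?_
  rintro ⟨n, w, hw, hwq⟩
  obtain ⟨m, ⟨m1, m2, m3, rfl, g1, g2, g3⟩, hsum⟩ := det_bound (x := fun t => y t + k t) (y := y)
    (k := k) (lb := lbar) (ub := ubar) (q := q) (S := S1 + S2) hη (fun t _ => rfl) hgap
    (fun t ht => hxl t ht.1) (fun t ht => hxu t ht.1)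
    (fun t r h1 h2 _ h4 => by
      have := (hmin t r h1 h2).2 (fun s p1 p2 => (hLlt s (by linarith)).mpr (h4 s p1 p2))
      linarith)
    (fun t r h1 h2 _ h4 => by
      have := (hmin t r h1 h2).1 (fun s p1 p2 => (hUlt s (by linarith)).mpr (h4 s p1 p2))
      linarith)
    (fun t ht _ => by
      obtain ⟨L, hL⟩ := hkc.2 t ht
      have e : Function.leftLim k t = L := leftLim_eq_of_tendsto hL
      have hj := hjump t ht
      rw [e] at hj
      refine ⟨L, hL, fun p => ?_, fun p => ?_⟩
      · have := hj.2 ((hLlt t ht.le).mpr p)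
        linarith
      · have := hj.1 ((hUlt t ht.le).mpr p)
        linarith)
    hkS w hw hwq n
  have o1 : (m1 : ℝ) ≤ OscN y η q := by exact_mod_cast ry.osc hη g1
  have o2 : (m2 : ℝ) ≤ OscN lbar η q := by exact_mod_cast rl.osc hη g2
  have o3 : (m3 : ℝ) ≤ OscN ubar η q := by exact_mod_cast ru.osc hη g3
  have hconv : ∑ i ∈ Finset.range n, edist (k (w (i + 1))) (k (w i)) =
      ENNReal.ofReal (∑ i ∈ Finset.range n, |k (w (i + 1)) - k (w i)|) := by
    rw [ENNReal.ofReal_sum_of_nonneg (fun _ _ => abs_nonneg _)]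
    refine Finset.sum_congr rfl fun i _ => ?_
    rw [edist_dist, Real.dist_eq]
  simp only
  rw [hconv]
  refine ENNReal.ofReal_le_ofReal (hsum.trans ?_)
  push_cast
  have hP : 0 ≤ (OscN y η q : ℝ) + (OscN lbar η q : ℝ) + (OscN ubar η q : ℝ) + 1 := by positivity
  calc 2 * (S1 + S2) * ((m1 : ℝ) + m2 + m3 + 1)
      ≤ 2 * (S1 + S2) * ((OscN y η q : ℝ) + (OscN lbar η q : ℝ) + (OscN ubar η q : ℝ) + 1) :=
        mul_le_mul_of_nonneg_left (by linarith) (by linarith)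
    _ ≤ _ := by
      have := mul_nonneg hP hS0
      linarith
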